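/- arXiv:2307.04062 — 4 statements merged into one kernel-verified Lean document; each statement's English description precedes it below -/
import Mathlib

section
/- Let u and v be orthonormal vectors in V. Then -1 ≤ R⁰(u,v,u,v) ≤ -1/4. Moreover R⁰(u,v,u,v) = -1 if and only if v = Ju or v = -Ju (i.e. the plane spanned by u and v is J-holomorphic), and R⁰(u,v,u,v) = -1/4 if and only if ⟨Ju,v⟩ = 0 (i.e. the plane spanned by u and v is totally real). -/
open scoped RealInnerProductSpace

/-- The constant `-1` holomorphic sectional curvature tensor `R⁰` (vector-valued version). -/
noncomputable def R0 {V : Type*} [NormedAddCommGroup V] [InnerProductSpace ℝ V]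
    (J : V →ₗ[ℝ] V) (X Y Z : V) : V :=
  (1/4 : ℝ) • (⟪Y, Z⟫ • X - ⟪X, Z⟫ • Y + ⟪J Y, Z⟫ • J X - ⟪J X, Z⟫ • J Y
    + (2 * ⟪X, J Y⟫) • J Z)

/-- The fully covariant version of `R⁰`. -/
noncomputable def R0cov {V : Type*} [NormedAddCommGroup V] [InnerProductSpace ℝ V]
    (J : V →ₗ[ℝ] V) (X Y Z T : V) : ℝ :=
  ⟪R0 J X Y Z, T⟫

theorem inner_J_right {V : Type*} [NormedAddCommGroup V] [InnerProductSpace ℝ V]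
    {J : V →ₗ[ℝ] V} (hJ2 : ∀ x : V, J (J x) = -x)
    (hJiso : ∀ x y : V, ⟪J x, J y⟫ = ⟪x, y⟫) (x y : V) : ⟪x, J y⟫ = -⟪J x, y⟫ := by
  rw [← hJiso x (J y), hJ2, inner_neg_right]

/-- The sectional curvature of `R⁰` on an orthonormal pair, in terms of the Kähler angle. -/
theorem R0cov_orthonormal {V : Type*} [NormedAddCommGroup V] [InnerProductSpace ℝ V]
    {J : V →ₗ[ℝ] V} (hJ2 : ∀ x : V, J (J x) = -x)
    (hJiso : ∀ x y : V, ⟪J x, J y⟫ = ⟪x, y⟫)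
    {u v : V} (hu : ‖u‖ = 1) (hv : ‖v‖ = 1) (huv : ⟪u, v⟫ = 0) :
    R0cov J u v u v = -(1 + 3 * ⟪J u, v⟫ ^ 2) / 4 := by
  have hJu : ⟪J u, u⟫ = 0 := by
    have h := inner_J_right hJ2 hJiso u u
    rw [real_inner_comm] at h
    linarith
  have hJv : ⟪J v, u⟫ = -⟪J u, v⟫ := by
    rw [real_inner_comm, inner_J_right hJ2 hJiso]
  simp only [R0cov, R0, inner_add_left, inner_sub_left, real_inner_smul_left,
    real_inner_self_eq_norm_sq, inner_J_right hJ2 hJiso u v, hu, hv, huv, hJu, hJv]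
  ring

theorem stmt_1 {V : Type*} [NormedAddCommGroup V] [InnerProductSpace ℝ V]
    (J : V →ₗ[ℝ] V)
    (hJ2 : ∀ x : V, J (J x) = -x)
    (hJiso : ∀ x y : V, ⟪J x, J y⟫ = ⟪x, y⟫)
    (u v : V) (hu : ‖u‖ = 1) (hv : ‖v‖ = 1) (huv : ⟪u, v⟫ = 0) :
    (-1 ≤ R0cov J u v u v ∧ R0cov J u v u v ≤ -(1/4)) ∧
    (R0cov J u v u v = -1 ↔ (v = J u ∨ v = -(J u))) ∧
    (R0cov J u v u v = -(1/4) ↔ ⟪J u, v⟫ = 0) := by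
  have hJu : ‖J u‖ = 1 := by
    rw [← hu, norm_eq_sqrt_real_inner, norm_eq_sqrt_real_inner, hJiso]
  have hc : |⟪J u, v⟫| ≤ 1 := by
    simpa [hJu, hv] using abs_real_inner_le_norm (J u) v
  have hc2 : ⟪J u, v⟫ ^ 2 ≤ 1 := (sq_le_one_iff_abs_le_one _).2 hc
  rw [R0cov_orthonormal hJ2 hJiso hu hv huv]
  refine ⟨⟨by linarith, by linarith [sq_nonneg ⟪J u, v⟫]⟩, ?_, ?_⟩
  · have h_pos : ⟪J u, v⟫ = 1 ↔ v = J u := by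
      rw [inner_eq_one_iff_of_norm_eq_one hJu hv, eq_comm]
    have h_neg : ⟪J u, v⟫ = -1 ↔ v = -(J u) := by
      rw [← inner_eq_one_iff_of_norm_eq_one (𝕜 := ℝ) hv (by rw [norm_neg, hJu]),
        inner_neg_right, real_inner_comm, neg_eq_iff_eq_neg]
    rw [← h_pos, ← h_neg, ← sq_eq_one_iff]
    constructor <;> intro h <;> linarith
  · rw [← sq_eq_zero_iff]
    constructor <;> intro h <;> linarith
end

section
/- Let u be a unit vector in V, let w be a vector with ‖w‖ ≤ 1, and let e be any vector in V. Then |R⁰(u,e,u,e) - R⁰(u,w,u,w)| ≤ 3·‖e - w‖ + (3/2)·‖e - w‖². In particular, if ‖e - Ju‖ ≤ ε then |R⁰(u,e,u,e) + 1| ≤ 3ε + (3/2)ε², and if w is a unit vector orthogonal to both u and Ju with ‖e - w‖ ≤ ε then |R⁰(u,e,u,e) + 1/4| ≤ 3ε + (3/2)ε². -/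
open scoped RealInnerProductSpace

section

variable {V : Type*} [NormedAddCommGroup V] [InnerProductSpace ℝ V] {J : V →ₗ[ℝ] V}

theorem inner_complexStructure_left (hJ2 : ∀ x : V, J (J x) = -x)
    (hJiso : ∀ x y : V, ⟪J x, J y⟫ = ⟪x, y⟫) (x y : V) : ⟪J x, y⟫ = -⟪x, J y⟫ := by
  rw [← hJiso x (J y), hJ2, inner_neg_right, neg_neg]

theorem inner_complexStructure_self (hJ2 : ∀ x : V, J (J x) = -x)
    (hJiso : ∀ x y : V, ⟪J x, J y⟫ = ⟪x, y⟫) (x : V) : ⟪J x, x⟫ = 0 := by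
  have h := inner_complexStructure_left hJ2 hJiso x x
  rw [real_inner_comm (J x) x] at h
  linarith

theorem norm_complexStructure (hJiso : ∀ x y : V, ⟪J x, J y⟫ = ⟪x, y⟫) (x : V) :
    ‖J x‖ = ‖x‖ := by
  rw [norm_eq_sqrt_real_inner, hJiso, ← norm_eq_sqrt_real_inner]

theorem R0cov_self (hJ2 : ∀ x : V, J (J x) = -x)
    (hJiso : ∀ x y : V, ⟪J x, J y⟫ = ⟪x, y⟫) {u : V} (hu : ‖u‖ = 1) (e : V) :
    R0cov J u e u e = (⟪u, e⟫ ^ 2 - ⟪e, e⟫ - 3 * ⟪J u, e⟫ ^ 2) / 4 := by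
  have hJu := inner_complexStructure_left hJ2 hJiso u e
  have hJe := inner_complexStructure_left hJ2 hJiso e u
  have huu : ⟪u, u⟫ = 1 := by rw [real_inner_self_eq_norm_sq, hu, one_pow]
  simp only [R0cov, R0, inner_add_left, inner_sub_left, real_inner_smul_left, huu, hJe,
    inner_complexStructure_self hJ2 hJiso]
  rw [real_inner_comm u e, real_inner_comm (J u) e, hJu]
  ring

theorem abs_R0cov_self_sub_le (hJ2 : ∀ x : V, J (J x) = -x)
    (hJiso : ∀ x y : V, ⟪J x, J y⟫ = ⟪x, y⟫) {u w : V} (hu : ‖u‖ = 1) (hw : ‖w‖ ≤ 1) (e : V) :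
    |R0cov J u e u e - R0cov J u w u w| ≤ 3 * ‖e - w‖ + (3/2) * ‖e - w‖ ^ 2 := by
  obtain ⟨d, rfl⟩ : ∃ d, e = w + d := ⟨e - w, by abel⟩
  rw [R0cov_self hJ2 hJiso hu, R0cov_self hJ2 hJiso hu, add_sub_cancel_left]
  simp only [inner_add_left, inner_add_right, real_inner_comm w d]
  have hd := norm_nonneg d
  have hJu : ‖J u‖ = 1 := (norm_complexStructure hJiso u).trans hu
  have abs_inner_le {x : V} (hx : ‖x‖ ≤ 1) (y : V) : |⟪x, y⟫| ≤ ‖y‖ :=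
    (abs_real_inner_le_norm x y).trans (mul_le_of_le_one_left (norm_nonneg y) hx)
  have had := abs_inner_le hu.le d
  have hbd := abs_inner_le hJu.le d
  have haw := (abs_inner_le hu.le w).trans hw
  have hbw := (abs_inner_le hJu.le w).trans hw
  have hwd := abs_le.mp (abs_inner_le hw d)
  have ha : |⟪u, w⟫ * ⟪u, d⟫| ≤ 1 * ‖d‖ := by rw [abs_mul]; gcongr
  have hb : |⟪J u, w⟫ * ⟪J u, d⟫| ≤ 1 * ‖d‖ := by rw [abs_mul]; gcongr
  have had2 := sq_le_sq' (abs_le.mp had).1 (abs_le.mp had).2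
  have hbd2 := sq_le_sq' (abs_le.mp hbd).1 (abs_le.mp hbd).2
  rw [abs_le] at ha hb ⊢
  have had0 := sq_nonneg ⟪u, d⟫
  have hbd0 := sq_nonneg ⟪J u, d⟫
  rw [real_inner_self_eq_norm_sq d]
  constructor <;> nlinarith

end

theorem stmt_6 {V : Type*} [NormedAddCommGroup V] [InnerProductSpace ℝ V]
    (J : V →ₗ[ℝ] V)
    (hJ2 : ∀ x : V, J (J x) = -x)
    (hJiso : ∀ x y : V, ⟪J x, J y⟫ = ⟪x, y⟫)
    (u w e : V) (hu : ‖u‖ = 1) (hw : ‖w‖ ≤ 1) :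
    |R0cov J u e u e - R0cov J u w u w| ≤ 3 * ‖e - w‖ + (3/2) * ‖e - w‖ ^ 2 ∧
    (∀ ε : ℝ, ‖e - J u‖ ≤ ε → |R0cov J u e u e + 1| ≤ 3 * ε + (3/2) * ε ^ 2) ∧
    (‖w‖ = 1 → ⟪w, u⟫ = 0 → ⟪w, J u⟫ = 0 →
      ∀ ε : ℝ, ‖e - w‖ ≤ ε → |R0cov J u e u e + 1/4| ≤ 3 * ε + (3/2) * ε ^ 2) := by
  have mono {t ε : ℝ} (h0 : 0 ≤ t) (h : t ≤ ε) :
      3 * t + (3/2) * t ^ 2 ≤ 3 * ε + (3/2) * ε ^ 2 := by gcongr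
  refine ⟨abs_R0cov_self_sub_le hJ2 hJiso hu hw e, fun ε hε => ?_, fun hw1 hwu hwJ ε hε => ?_⟩
  · have hJu : ‖J u‖ = 1 := (norm_complexStructure hJiso u).trans hu
    have hR : R0cov J u (J u) u (J u) = -1 := by
      rw [R0cov_self hJ2 hJiso hu, real_inner_comm, inner_complexStructure_self hJ2 hJiso,
        real_inner_self_eq_norm_sq, hJu]
      norm_num
    have h := abs_R0cov_self_sub_le hJ2 hJiso hu hJu.le e
    rw [hR, sub_neg_eq_add] at h
    exact h.trans (mono (norm_nonneg _) hε)
  · have hR : R0cov J u w u w = -(1/4) := by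
      rw [R0cov_self hJ2 hJiso hu, real_inner_comm, hwu, real_inner_comm w (J u), hwJ,
        real_inner_self_eq_norm_sq, hw1]
      norm_num
    have h := abs_R0cov_self_sub_le hJ2 hJiso hu hw e
    rw [hR, sub_neg_eq_add] at h
    exact h.trans (mono (norm_nonneg _) hε)
end

section
/- Let λ > 0, b > 0 and C ≥ 0, and let f : [0,∞) → ℝ be twice continuously differentiable with |f''(r) + λ·f'(r)| ≤ C·e^{-br} for all r ≥ 0. Then f converges as r → ∞ to a finite limit ℓ, and as r → ∞ both |f'(r)| and |f(r) - ℓ| are O(e^{-br}) if b < λ, O((r+1)·e^{-λr}) if b = λ, and O(e^{-λr}) if b > λ. -/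
open Filter Asymptotics Real Set

/-- A function on `[0, ∞)` whose derivative is dominated by `-Φ'`, where `Φ → 0`, converges, and
`Φ` bounds its distance to the limit. -/
lemma exists_tendsto_abs_sub_le {f g Φ φ : ℝ → ℝ}
    (hf : ∀ x, 0 ≤ x → HasDerivWithinAt f (g x) (Ici 0) x)
    (hΦ : ∀ x, HasDerivAt Φ (-φ x) x) (hle : ∀ x, 0 ≤ x → |g x| ≤ φ x)
    (hlim : Tendsto Φ atTop (nhds 0)) :
    ∃ ℓ : ℝ, Tendsto f atTop (nhds ℓ) ∧ ∀ x, 0 ≤ x → |f x - ℓ| ≤ Φ x := by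
  have key : ∀ x y, 0 ≤ x → x ≤ y → |f y - f x| ≤ Φ x - Φ y := by
    intro x y hx hxy
    have hcont : ContinuousOn (fun t => f t - f x) (Icc x y) := fun t ht =>
      (((hf t (hx.trans ht.1)).continuousWithinAt.mono
        fun s hs => mem_Ici.2 (hx.trans hs.1))).sub continuousWithinAt_const
    exact image_norm_le_of_norm_deriv_right_le_deriv_boundary (f' := g)
      (B := fun t => Φ x - Φ t) (B' := φ) hcont
      (fun t ht => ((hf t (hx.trans ht.1)).mono
        (Ici_subset_Ici.2 (hx.trans ht.1))).sub_const (f x))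
      (by simp)
      (fun t => by simpa using (hΦ t).const_sub (Φ x))
      (fun t ht => hle t (hx.trans ht.1)) ⟨hxy, le_rfl⟩
  have hcauchy : CauchySeq f := by
    refine Metric.cauchySeq_iff'.2 fun ε hε => ?_
    obtain ⟨N, hN⟩ := Metric.tendsto_atTop.1 hlim (ε / 2) (half_pos hε)
    refine ⟨max N 0, fun n hn => ?_⟩
    have h1 := hN (max N 0) (le_max_left _ _)
    have h2 := hN n ((le_max_left _ _).trans hn)
    rw [Real.dist_eq, sub_zero, abs_lt] at h1 h2
    rw [Real.dist_eq]
    linarith [key _ n (le_max_right N 0) hn]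
  obtain ⟨ℓ, hℓ⟩ := cauchySeq_tendsto_of_complete hcauchy
  refine ⟨ℓ, hℓ, fun x hx => ?_⟩
  have h1 : Tendsto (fun y => |f y - f x|) atTop (nhds |ℓ - f x|) := (hℓ.sub_const _).abs
  have h2 : Tendsto (fun y => Φ x - Φ y) atTop (nhds (Φ x - 0)) := hlim.const_sub _
  rw [abs_sub_comm, ← sub_zero (Φ x)]
  exact le_of_tendsto_of_tendsto h1 h2
    ((eventually_ge_atTop x).mono fun y hy => key x y hx hy)

/-- Duhamel-type bound for `g' + lam * g`. -/
lemma abs_le_mul_exp_of_abs_deriv_add_le {g g' B : ℝ → ℝ} {lam b C : ℝ}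
    (hg : ∀ x, 0 ≤ x → HasDerivWithinAt g (g' x) (Ici 0) x)
    (hineq : ∀ x, 0 ≤ x → |g' x + lam * g x| ≤ C * exp (-b * x))
    (hB : ∀ x, HasDerivAt B (C * exp ((lam - b) * x)) x) (hB0 : |g 0| ≤ B 0)
    {x : ℝ} (hx : 0 ≤ x) : |g x| ≤ B x * exp (-lam * x) := by
  have hexp : ∀ t : ℝ, HasDerivAt (fun t => exp (lam * t)) (exp (lam * t) * lam) t := fun t => by
    simpa using ((hasDerivAt_id t).const_mul lam).exp
  have hu : ∀ t, 0 ≤ t → HasDerivWithinAt (fun t => exp (lam * t) * g t)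
      (exp (lam * t) * (g' t + lam * g t)) (Ici 0) t := fun t ht =>
    ((hexp t).hasDerivWithinAt.mul (hg t ht)).congr_deriv (by ring)
  have h : ‖exp (lam * x) * g x‖ ≤ B x :=
    image_norm_le_of_norm_deriv_right_le_deriv_boundary (a := 0) (b := x)
      (f := fun t => exp (lam * t) * g t)
      (fun t ht => (hu t ht.1).continuousWithinAt.mono fun s hs => hs.1)
      (fun t ht => (hu t ht.1).mono (Ici_subset_Ici.2 ht.1))
      (by simpa using hB0) hB
      (fun t ht => by
        rw [Real.norm_eq_abs, abs_mul, abs_of_pos (exp_pos _)]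
        calc exp (lam * t) * |g' t + lam * g t| ≤ exp (lam * t) * (C * exp (-b * t)) := by
              gcongr; exact hineq t ht.1
          _ = C * exp ((lam - b) * t) := by
              rw [mul_left_comm, ← exp_add]; ring_nf)
      ⟨hx, le_rfl⟩
  rw [Real.norm_eq_abs, abs_mul, abs_of_pos (exp_pos _)] at h
  rw [neg_mul, exp_neg, ← div_eq_mul_inv, le_div_iff₀ (exp_pos _), mul_comm]
  exact h

lemma tendsto_exp_neg_mul_atTop {a : ℝ} (ha : 0 < a) :
    Tendsto (fun x => exp (-a * x)) atTop (nhds 0) :=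
  tendsto_exp_atBot.comp (tendsto_id.const_mul_atTop_of_neg (neg_lt_zero.2 ha))

lemma hasDerivAt_exp_mul (a x : ℝ) : HasDerivAt (fun x => exp (a * x)) (a * exp (a * x)) x := by
  simpa [mul_comm] using ((hasDerivAt_id x).const_mul a).exp

lemma isBigO_atTop_of_abs_le {u w : ℝ → ℝ} (K : ℝ) (hw : ∀ x, 0 ≤ x → 0 ≤ w x)
    (h : ∀ x, 0 ≤ x → |u x| ≤ K * w x) : u =O[atTop] w :=
  .of_bound K <| (eventually_ge_atTop 0).mono fun x hx => by
    simpa [abs_of_nonneg (hw x hx)] using h x hx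

/-- An exponentially decaying derivative forces exponential convergence. -/
lemma exists_tendsto_isBigO_exp {f g : ℝ → ℝ} {a : ℝ} (K : ℝ) (ha : 0 < a)
    (hf : ∀ x, 0 ≤ x → HasDerivWithinAt f (g x) (Ici 0) x)
    (hle : ∀ x, 0 ≤ x → |g x| ≤ K * exp (-a * x)) :
    ∃ ℓ : ℝ, Tendsto f atTop (nhds ℓ) ∧ (g =O[atTop] fun r => exp (-a * r)) ∧
      ((fun r => f r - ℓ) =O[atTop] fun r => exp (-a * r)) := by
  obtain ⟨ℓ, h1, h2⟩ := exists_tendsto_abs_sub_le (Φ := fun x => K / a * exp (-a * x)) hf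
    (fun x => ((hasDerivAt_exp_mul (-a) x).const_mul (K / a)).congr_deriv (by field_simp)) hle
    (by simpa using (tendsto_exp_neg_mul_atTop ha).const_mul (K / a))
  exact ⟨ℓ, h1, isBigO_atTop_of_abs_le K (fun x _ => (exp_pos _).le) hle,
    isBigO_atTop_of_abs_le (K / a) (fun x _ => (exp_pos _).le) h2⟩

/-- The analogue of `exists_tendsto_isBigO_exp` with a linear factor. -/
lemma exists_tendsto_isBigO_add_one_mul_exp {f g : ℝ → ℝ} {a K : ℝ} (ha : 0 < a) (hK : 0 ≤ K)
    (hf : ∀ x, 0 ≤ x → HasDerivWithinAt f (g x) (Ici 0) x)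
    (hle : ∀ x, 0 ≤ x → |g x| ≤ K * ((x + 1) * exp (-a * x))) :
    ∃ ℓ : ℝ, Tendsto f atTop (nhds ℓ) ∧ (g =O[atTop] fun r => (r + 1) * exp (-a * r)) ∧
      ((fun r => f r - ℓ) =O[atTop] fun r => (r + 1) * exp (-a * r)) := by
  have hlin : Tendsto (fun x => x * exp (-a * x)) atTop (nhds 0) := by
    simpa using tendsto_rpow_mul_exp_neg_mul_atTop_nhds_zero 1 a ha
  have hexp := tendsto_exp_neg_mul_atTop ha
  have hpos : ∀ x : ℝ, 0 ≤ x → 0 ≤ (x + 1) * exp (-a * x) := fun x hx => by positivity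
  obtain ⟨ℓ, h1, h2⟩ := exists_tendsto_abs_sub_le
    (Φ := fun x => K * (((x + 1) / a + 1 / a ^ 2) * exp (-a * x))) hf
    (fun x => by
      refine ((((((hasDerivAt_id' x).add_const 1).div_const a).add_const (1 / a ^ 2)).mul
        (hasDerivAt_exp_mul (-a) x)).const_mul K).congr_deriv ?_
      field_simp
      ring) hle
    (by
      have h := ((hlin.const_mul (1 / a)).add (hexp.const_mul (1 / a + 1 / a ^ 2))).const_mul K
      simp only [mul_zero, add_zero] at h
      refine h.congr fun x => ?_
      ring)
  refine ⟨ℓ, h1, isBigO_atTop_of_abs_le K hpos hle,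
    isBigO_atTop_of_abs_le (K * (1 / a + 1 / a ^ 2)) hpos fun x hx => (h2 x hx).trans ?_⟩
  rw [mul_assoc, ← mul_assoc (1 / a + 1 / a ^ 2)]
  have : 0 ≤ 1 / a ^ 2 * x := by positivity
  gcongr
  calc (x + 1) / a + 1 / a ^ 2 ≤ (x + 1) / a + 1 / a ^ 2 + 1 / a ^ 2 * x := by linarith
    _ = (1 / a + 1 / a ^ 2) * (x + 1) := by ring

theorem stmt_10 (lam b C : ℝ) (hlam : 0 < lam) (hb : 0 < b) (hC : 0 ≤ C)
    (f : ℝ → ℝ) (hf : ContDiffOn ℝ 2 f (Ici 0))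
    (hineq : ∀ r : ℝ, 0 ≤ r →
      |derivWithin (derivWithin f (Ici 0)) (Ici 0) r
        + lam * derivWithin f (Ici 0) r| ≤ C * exp (-b * r)) :
    ∃ ℓ : ℝ, Tendsto f atTop (nhds ℓ) ∧
      (b < lam →
        (derivWithin f (Ici 0) =O[atTop] fun r => exp (-b * r)) ∧
        ((fun r => f r - ℓ) =O[atTop] fun r => exp (-b * r))) ∧
      (b = lam →
        (derivWithin f (Ici 0) =O[atTop] fun r => (r + 1) * exp (-lam * r)) ∧
        ((fun r => f r - ℓ) =O[atTop] fun r => (r + 1) * exp (-lam * r))) ∧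
      (lam < b →
        (derivWithin f (Ici 0) =O[atTop] fun r => exp (-lam * r)) ∧
        ((fun r => f r - ℓ) =O[atTop] fun r => exp (-lam * r))) := by
  set g := derivWithin f (Ici 0) with hg_def
  have hf1 : ∀ x, 0 ≤ x → HasDerivWithinAt f (g x) (Ici 0) x := fun x hx =>
    (hf.differentiableOn (by norm_num) x hx).hasDerivWithinAt
  have hgC : ContDiffOn ℝ 1 g (Ici 0) :=
    hf.derivWithin (uniqueDiffOn_Ici 0) (by norm_num)
  have hg : ∀ x, 0 ≤ x → HasDerivWithinAt g (derivWithin g (Ici 0) x) (Ici 0) x := fun x hx =>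
    (hgC.differentiableOn (by norm_num) x hx).hasDerivWithinAt
  rcases lt_trichotomy b lam with h | h | h
  · have hd : 0 < lam - b := sub_pos.2 h
    obtain ⟨ℓ, h1, h2⟩ := exists_tendsto_isBigO_exp (|g 0| + C / (lam - b)) hb hf1 fun x hx => by
      have h3 := abs_le_mul_exp_of_abs_deriv_add_le hg hineq
        (B := fun x => |g 0| + C / (lam - b) * exp ((lam - b) * x))
        (fun x => (((hasDerivAt_exp_mul (lam - b) x).const_mul _).const_add _).congr_deriv
          (by field_simp))
        (by simp only [mul_zero, exp_zero]; linarith [div_nonneg hC hd.le]) hx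
      have h4 : 1 ≤ exp ((lam - b) * x) := one_le_exp (by positivity)
      calc |g x| ≤ (|g 0| + C / (lam - b) * exp ((lam - b) * x)) * exp (-lam * x) := h3
        _ ≤ (|g 0| * exp ((lam - b) * x) + C / (lam - b) * exp ((lam - b) * x))
              * exp (-lam * x) := by
            gcongr
            exact le_mul_of_one_le_right (abs_nonneg _) h4
        _ = (|g 0| + C / (lam - b)) * (exp ((lam - b) * x) * exp (-lam * x)) := by ring
        _ = (|g 0| + C / (lam - b)) * exp (-b * x) := by rw [← exp_add]; ring_nf
    exact ⟨ℓ, h1, fun _ => h2, fun h' => absurd h' h.ne, fun h' => absurd h' h.not_gt⟩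
  · obtain ⟨ℓ, h1, h2⟩ := exists_tendsto_isBigO_add_one_mul_exp (K := |g 0| + C) hlam
      (by positivity) hf1 fun x hx => by
        have h3 := abs_le_mul_exp_of_abs_deriv_add_le hg hineq (B := fun x => |g 0| + C * x)
          (fun x => (((hasDerivAt_id' x).const_mul C).const_add _).congr_deriv (by simp [h]))
          (by simp) hx
        refine h3.trans ?_
        rw [← mul_assoc]
        gcongr
        nlinarith [mul_nonneg (abs_nonneg (g 0)) hx]
    exact ⟨ℓ, h1, fun h' => absurd h h'.ne, fun _ => h2, fun h' => absurd h h'.ne'⟩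
  · have hd : 0 < b - lam := sub_pos.2 h
    obtain ⟨ℓ, h1, h2⟩ := exists_tendsto_isBigO_exp (|g 0| + C / (b - lam)) hlam hf1 fun x hx => by
      have h3 := abs_le_mul_exp_of_abs_deriv_add_le hg hineq
        (B := fun x => |g 0| + C / (b - lam) - C / (b - lam) * exp ((lam - b) * x))
        (fun x => (((hasDerivAt_exp_mul (lam - b) x).const_mul _).const_sub _).congr_deriv
          (by field_simp; ring))
        (by simp) hx
      refine h3.trans ?_
      gcongr
      exact sub_le_self _ (by positivity)
    exact ⟨ℓ, h1, fun h' => absurd h' h.not_gt, fun h' => absurd h' h.ne', fun _ => h2⟩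
end

section
/- Let a > 1 and C ≥ 0, and let f : [0,∞) → ℝ be twice continuously differentiable with |f''(r) - f(r)| ≤ C·e^{(2-a)r} for all r ≥ 0. Then the function r ↦ e^{-r}·f(r) converges as r → ∞ to a finite limit ℓ, and as r → ∞ both |(e^{-r}f)'(r)| and |e^{-r}f(r) - ℓ| are O(e^{-(a-1)r}) if 1 < a < 3, O((r+1)·e^{-2r}) if a = 3, and O(e^{-2r}) if a > 3. -/
open Filter Asymptotics Real Set

theorem abs_sub_le_of_abs_hasDerivWithinAt_le {g g' B b : ℝ → ℝ}
    (hg : ∀ r, 0 ≤ r → HasDerivWithinAt g (g' r) (Ici 0) r)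
    (hB : ∀ r, 0 ≤ r → HasDerivAt B (b r) r)
    (hle : ∀ r, 0 ≤ r → |g' r| ≤ b r) {x y : ℝ} (hx : 0 ≤ x) (hxy : x ≤ y) :
    |g y - g x| ≤ B y - B x := by
  have hadd : MonotoneOn (fun r => B r + g r) (Ici 0) := by
    refine monotoneOn_of_hasDerivWithinAt_nonneg (f' := fun r => b r + g' r) (convex_Ici 0)
      (fun r hr => ((hB r hr).hasDerivWithinAt.add (hg r hr)).continuousWithinAt) ?_ ?_
    · exact fun r hr => ((hB r (interior_subset hr)).hasDerivWithinAt.add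
        (hg r (interior_subset hr))).mono interior_subset
    · intro r hr
      linarith [neg_le_of_abs_le (hle r (interior_subset hr))]
  have hsub : MonotoneOn (fun r => B r - g r) (Ici 0) := by
    refine monotoneOn_of_hasDerivWithinAt_nonneg (f' := fun r => b r - g' r) (convex_Ici 0)
      (fun r hr => ((hB r hr).hasDerivWithinAt.sub (hg r hr)).continuousWithinAt) ?_ ?_
    · exact fun r hr => ((hB r (interior_subset hr)).hasDerivWithinAt.sub
        (hg r (interior_subset hr))).mono interior_subset
    · intro r hr
      linarith [le_of_abs_le (hle r (interior_subset hr))]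
  have h₁ := hadd hx (hx.trans hxy) hxy
  have h₂ := hsub hx (hx.trans hxy) hxy
  simp only at h₁ h₂
  rw [abs_le]
  constructor <;> linarith

theorem exists_tendsto_of_abs_hasDerivWithinAt_le {g g' β b : ℝ → ℝ}
    (hg : ∀ r, 0 ≤ r → HasDerivWithinAt g (g' r) (Ici 0) r)
    (hβ : ∀ r, 0 ≤ r → HasDerivAt β (-b r) r)
    (hle : ∀ r, 0 ≤ r → |g' r| ≤ b r) (hβ0 : ∀ r, 0 ≤ r → 0 ≤ β r)
    (hlim : Tendsto β atTop (nhds 0)) :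
    ∃ ℓ : ℝ, Tendsto g atTop (nhds ℓ) ∧ ∀ r, 0 ≤ r → |g r - ℓ| ≤ β r := by
  have hinc : ∀ x y, 0 ≤ x → x ≤ y → |g y - g x| ≤ β x := by
    intro x y hx hxy
    have h := abs_sub_le_of_abs_hasDerivWithinAt_le (B := fun r => -β r) (b := b) hg
      (fun r hr => (hβ r hr).neg.congr_deriv (neg_neg _)) hle hx hxy
    linarith [hβ0 y (hx.trans hxy)]
  have hmax : (fun r : ℝ => max r 0) =ᶠ[atTop] id := by
    filter_upwards [eventually_ge_atTop 0] with r hr using max_eq_left hr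
  have hcauchy : CauchySeq fun r => g (max r 0) := by
    refine cauchySeq_of_le_tendsto_0' (fun r => β (max r 0)) (fun x y hxy => ?_)
      (hlim.congr' (hmax.fun_comp β).symm)
    rw [dist_comm, Real.dist_eq]
    exact hinc _ _ (le_max_right _ _) (max_le_max_right 0 hxy)
  obtain ⟨ℓ, hℓ⟩ := cauchySeq_tendsto_of_complete hcauchy
  have hgl : Tendsto g atTop (nhds ℓ) := hℓ.congr' (hmax.fun_comp g)
  refine ⟨ℓ, hgl, fun r hr => ?_⟩
  rw [abs_sub_comm]
  refine le_of_tendsto (hgl.sub_const (g r)).abs ?_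
  filter_upwards [eventually_ge_atTop r] with y hy using hinc r y hr hy

theorem exists_tendsto_and_isBigO_of_abs_hasDerivWithinAt_le {g g' β φ : ℝ → ℝ} {K : ℝ}
    (hg : ∀ r, 0 ≤ r → HasDerivWithinAt g (g' r) (Ici 0) r)
    (hβ : ∀ r, 0 ≤ r → HasDerivAt β (-(K * φ r)) r)
    (hle : ∀ r, 0 ≤ r → |g' r| ≤ K * φ r) (hβ0 : ∀ r, 0 ≤ r → 0 ≤ β r)
    (hlim : Tendsto β atTop (nhds 0)) (hβφ : β =O[atTop] φ) :
    ∃ ℓ : ℝ, Tendsto g atTop (nhds ℓ) ∧ derivWithin g (Ici 0) =O[atTop] φ ∧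
      (fun r => g r - ℓ) =O[atTop] φ := by
  obtain ⟨ℓ, hℓ, hbound⟩ := exists_tendsto_of_abs_hasDerivWithinAt_le hg hβ hle hβ0 hlim
  refine ⟨ℓ, hℓ, ?_, ?_⟩
  · refine IsBigO.trans (IsBigO.of_bound 1 ?_) (isBigO_const_mul_self K φ atTop)
    filter_upwards [eventually_ge_atTop 0] with r hr
    rw [(hg r hr).derivWithin (uniqueDiffOn_Ici 0 r hr), one_mul]
    exact (hle r hr).trans (le_abs_self _)
  · refine IsBigO.trans (IsBigO.of_bound 1 ?_) hβφ
    filter_upwards [eventually_ge_atTop 0] with r hr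
    rw [one_mul]
    exact (hbound r hr).trans (le_abs_self _)

theorem hasDerivAt_exp_const_mul (c r : ℝ) :
    HasDerivAt (fun s => exp (c * s)) (c * exp (c * r)) r := by
  simpa [mul_comm] using ((hasDerivAt_id r).const_mul c).exp

theorem tendsto_exp_neg_const_mul_atTop {c : ℝ} (hc : 0 < c) :
    Tendsto (fun r => exp (-c * r)) atTop (nhds 0) :=
  tendsto_exp_atBot.comp (tendsto_id.const_mul_atTop_of_neg (neg_neg_of_pos hc))

theorem stmt_11 (a C : ℝ) (ha : 1 < a) (hC : 0 ≤ C)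
    (f : ℝ → ℝ) (hf : ContDiffOn ℝ 2 f (Ici 0))
    (hineq : ∀ r : ℝ, 0 ≤ r →
      |derivWithin (derivWithin f (Ici 0)) (Ici 0) r - f r| ≤ C * exp ((2 - a) * r)) :
    ∃ ℓ : ℝ, Tendsto (fun r => exp (-r) * f r) atTop (nhds ℓ) ∧
      (a < 3 →
        (derivWithin (fun r => exp (-r) * f r) (Ici 0) =O[atTop]
          fun r => exp (-(a - 1) * r)) ∧
        ((fun r => exp (-r) * f r - ℓ) =O[atTop] fun r => exp (-(a - 1) * r))) ∧
      (a = 3 →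
        (derivWithin (fun r => exp (-r) * f r) (Ici 0) =O[atTop]
          fun r => (r + 1) * exp (-2 * r)) ∧
        ((fun r => exp (-r) * f r - ℓ) =O[atTop] fun r => (r + 1) * exp (-2 * r))) ∧
      (3 < a →
        (derivWithin (fun r => exp (-r) * f r) (Ici 0) =O[atTop]
          fun r => exp (-2 * r)) ∧
        ((fun r => exp (-r) * f r - ℓ) =O[atTop] fun r => exp (-2 * r))) := by
  have hU := uniqueDiffOn_Ici (0 : ℝ)
  set f₁ := derivWithin f (Ici 0)
  have hd₁ : ∀ r, 0 ≤ r → HasDerivWithinAt f (f₁ r) (Ici 0) r := fun r hr =>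
    (hf.differentiableOn (by norm_num) r hr).hasDerivWithinAt
  have hd₂ : ∀ r, 0 ≤ r → HasDerivWithinAt f₁ (derivWithin f₁ (Ici 0) r) (Ici 0) r :=
    fun r hr => ((hf.derivWithin hU (m := 1) (by norm_num)).differentiableOn
      (by norm_num) r hr).hasDerivWithinAt
  set u : ℝ → ℝ := fun r => exp r * (f₁ r - f r) with hu
  have hg : ∀ r, 0 ≤ r →
      HasDerivWithinAt (fun r => exp (-r) * f r) (exp (-2 * r) * u r) (Ici 0) r := by
    intro r hr
    have h := (hasDerivAt_neg r).exp.hasDerivWithinAt.mul (hd₁ r hr)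
    refine h.congr_deriv ?_
    have he : exp (-2 * r) * exp r = exp (-r) := by rw [← exp_add]; ring_nf
    simp only [hu]
    rw [← mul_assoc, he]
    ring
  have hu' : ∀ r, 0 ≤ r → HasDerivWithinAt u
      (exp r * (derivWithin f₁ (Ici 0) r - f r)) (Ici 0) r := by
    intro r hr
    refine ((Real.hasDerivAt_exp r).hasDerivWithinAt.mul
      ((hd₂ r hr).sub (hd₁ r hr))).congr_deriv ?_
    simp only [Pi.sub_apply]
    ring
  have hule : ∀ r, 0 ≤ r →
      |exp r * (derivWithin f₁ (Ici 0) r - f r)| ≤ C * exp ((3 - a) * r) := by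
    intro r hr
    rw [abs_mul, abs_exp]
    calc _ ≤ exp r * (C * exp ((2 - a) * r)) := by gcongr; exact hineq r hr
      _ = C * (exp r * exp ((2 - a) * r)) := by ring
      _ = _ := by rw [← exp_add]; ring_nf
  have hgle : ∀ r M, |u r| ≤ M → |exp (-2 * r) * u r| ≤ M * exp (-2 * r) := by
    intro r M h
    rw [abs_mul, abs_exp, mul_comm]
    gcongr
  have hu_le : ∀ {B : ℝ → ℝ}, (∀ r, 0 ≤ r → HasDerivAt B (C * exp ((3 - a) * r)) r) →
      ∀ r, 0 ≤ r → |u r| ≤ |u 0| + (B r - B 0) := by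
    intro B hB r hr
    have h₁ := abs_sub_le_of_abs_hasDerivWithinAt_le hu' hB hule le_rfl hr
    linarith [abs_sub_abs_le_abs_sub (u r) (u 0)]
  have hlim₂ := tendsto_exp_neg_const_mul_atTop (c := 2) two_pos
  have hB : a ≠ 3 → ∀ r, 0 ≤ r → |u r| ≤
      |u 0| + (C / (3 - a) * exp ((3 - a) * r) - C / (3 - a)) := by
    intro h3 r hr
    have h3' : 3 - a ≠ 0 := sub_ne_zero.mpr h3.symm
    have h := hu_le (B := fun r => C / (3 - a) * exp ((3 - a) * r)) (fun r _ =>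
      ((hasDerivAt_exp_const_mul (3 - a) r).const_mul _).congr_deriv (by field_simp)) r hr
    simpa using h
  rcases lt_trichotomy a 3 with h3 | h3 | h3
  · have hK : 0 ≤ C / (3 - a) := div_nonneg hC (by linarith)
    obtain ⟨ℓ, hℓ, h₁, h₂⟩ := exists_tendsto_and_isBigO_of_abs_hasDerivWithinAt_le
      (K := |u 0| + C / (3 - a)) (φ := fun r => exp (-(a - 1) * r))
      (β := fun r => (|u 0| + C / (3 - a)) / (a - 1) * exp (-(a - 1) * r)) hg
      (fun r _ => by
        have : a - 1 ≠ 0 := by linarith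
        exact ((hasDerivAt_exp_const_mul (-(a - 1)) r).const_mul _).congr_deriv
          (by field_simp))
      (fun r hr => by
        have h1 : 1 ≤ exp ((3 - a) * r) := one_le_exp (mul_nonneg (by linarith) hr)
        have h := hgle r ((|u 0| + C / (3 - a)) * exp ((3 - a) * r))
          ((hB h3.ne r hr).trans (by nlinarith [abs_nonneg (u 0)]))
        refine h.trans_eq ?_
        rw [mul_assoc, ← exp_add]
        ring_nf)
      (fun r _ => by
        have : 0 < a - 1 := by linarith
        positivity)
      (by simpa using (tendsto_exp_neg_const_mul_atTop (c := a - 1) (by linarith)).const_mul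
            ((|u 0| + C / (3 - a)) / (a - 1)))
      (isBigO_const_mul_self _ _ _)
    exact ⟨ℓ, hℓ, fun _ => ⟨h₁, h₂⟩, fun h => absurd h h3.ne, fun h => absurd h h3.not_gt⟩
  · obtain ⟨ℓ, hℓ, h₁, h₂⟩ := exists_tendsto_and_isBigO_of_abs_hasDerivWithinAt_le
      (K := |u 0| + C) (φ := fun r => (r + 1) * exp (-2 * r))
      (β := fun r => (|u 0| + C) * ((r / 2 + 3 / 4) * exp (-2 * r))) hg
      (fun r _ => ((((hasDerivAt_id r).div_const 2).add_const (3 / 4)).mul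
        (hasDerivAt_exp_const_mul (-2) r)).const_mul _ |>.congr_deriv (by simp only [id]; ring))
      (fun r hr => by
        have h := hu_le (B := fun r => C * r) (fun r _ => by
          simpa [h3] using (hasDerivAt_id r).const_mul C) r hr
        exact (hgle r ((|u 0| + C) * (r + 1))
          (h.trans (by nlinarith [mul_nonneg (abs_nonneg (u 0)) hr]))).trans_eq (mul_assoc _ _ _))
      (fun r hr => by positivity)
      (by
        have h := (tendsto_pow_mul_exp_neg_atTop_nhds_zero 1).comp
          (tendsto_id.const_mul_atTop (two_pos (α := ℝ)))
        have h' := ((h.div_const 4).add (hlim₂.const_mul (3 / 4))).const_mul (|u 0| + C)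
        simp only [zero_div, mul_zero, add_zero] at h'
        refine h'.congr fun r => ?_
        simp only [Function.comp, id, pow_one, neg_mul]
        ring)
      (by
        refine (IsBigO.of_bound 1 ?_).const_mul_left _
        filter_upwards [eventually_ge_atTop 0] with r hr
        rw [one_mul, norm_of_nonneg (by positivity), norm_of_nonneg (by positivity)]
        gcongr
        · linarith
        · norm_num)
    exact ⟨ℓ, hℓ, fun h => absurd h3 h.ne, fun _ => ⟨h₁, h₂⟩, fun h => absurd h3 h.ne'⟩
  · have hK : 0 ≤ C / (a - 3) := div_nonneg hC (by linarith)
    obtain ⟨ℓ, hℓ, h₁, h₂⟩ := exists_tendsto_and_isBigO_of_abs_hasDerivWithinAt_le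
      (K := |u 0| + C / (a - 3)) (φ := fun r => exp (-2 * r))
      (β := fun r => (|u 0| + C / (a - 3)) / 2 * exp (-2 * r)) hg
      (fun r _ => ((hasDerivAt_exp_const_mul (-2) r).const_mul _).congr_deriv (by ring))
      (fun r hr => by
        refine hgle r _ ((hB h3.ne' r hr).trans ?_)
        have hneg : C / (3 - a) = -(C / (a - 3)) := by rw [← neg_sub, div_neg]
        rw [hneg]
        nlinarith [mul_nonneg hK (exp_pos ((3 - a) * r)).le])
      (fun r _ => by positivity)
      (by simpa using hlim₂.const_mul ((|u 0| + C / (a - 3)) / 2))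
      (isBigO_const_mul_self _ _ _)
    exact ⟨ℓ, hℓ, fun h => absurd h h3.not_gt, fun h => absurd h h3.ne', fun _ => ⟨h₁, h₂⟩⟩
end
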